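/- If u = Σ_n u_n(y)e^{inx/r}/√(2πr) with u_n(y) = a_n y^{1/2} I_{-ik}(|n|y/r) + b_n y^{1/2} K_{ik}(|n|y/r) for n ≠ 0, and if Σ_n |a_n I_{-ik}(|n|y/r)|² < ∞ and ‖u(·,y)‖²_{L²} < ∞ for each y > 1, then Σ_{n≠0}|b_n K_{ik}(|n|y/r)|² < ∞ for each y > 1; consequently, since K_{ik}(t) decays like e^{-t}, the sequence (b_n) satisfies Σ|b_n|²ρ^{-|n|} < ∞ for some ρ > 1. -/

import Mathlib

open Complex

/-- The modified Bessel function of the first kind. -/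
noncomputable def besselI (ν z : ℂ) : ℂ :=
  (z / 2) ^ ν * ∑' n : ℕ, (z ^ 2 / 4) ^ n / ((n.factorial : ℂ) * Complex.Gamma (ν + n + 1))

/-- The modified Bessel function of the second kind. -/
noncomputable def besselK (ν z : ℂ) : ℂ :=
  (Real.pi / 2) * (besselI (-ν) z - besselI ν z) / Complex.sin (ν * Real.pi)

open Filter Topology

theorem summable_mul_pow_of_norm_le_div_factorial {c : ℕ → ℂ} {C : ℝ}
    (hc : ∀ n, ‖c n‖ ≤ C / n.factorial) (x : ℂ) : Summable fun n => c n * x ^ n := by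
  refine Summable.of_norm_bounded
    ((Real.summable_pow_div_factorial ‖x‖).mul_left C) fun n => ?_
  rw [norm_mul, norm_pow]
  calc ‖c n‖ * ‖x‖ ^ n ≤ (C / n.factorial) * ‖x‖ ^ n := by gcongr; exact hc n
    _ = _ := by ring

theorem norm_succ_mul_le_div_factorial {c : ℕ → ℂ} {C : ℝ}
    (hc : ∀ n, ‖c n‖ ≤ C / n.factorial) (n : ℕ) :
    ‖(n + 1 : ℕ) * c (n + 1)‖ ≤ C / n.factorial := by
  rw [norm_mul, Complex.norm_natCast]
  calc ((n + 1 : ℕ) : ℝ) * ‖c (n + 1)‖ ≤ (n + 1 : ℕ) * (C / (n + 1).factorial) := by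
        gcongr; exact hc (n + 1)
    _ = C / n.factorial := by
      rw [Nat.factorial_succ]
      have : (n.factorial : ℝ) ≠ 0 := by positivity
      push_cast
      field_simp

/-- The sum of an entire power series whose coefficients are dominated by `C / n!` is
differentiated termwise. -/
theorem hasDerivAt_tsum_of_norm_le_div_factorial {c : ℕ → ℂ} {C : ℝ}
    (hc : ∀ n, ‖c n‖ ≤ C / n.factorial) (x : ℂ) :
    HasDerivAt (fun z : ℂ => ∑' n, c n * z ^ n) (∑' n, ((n + 1 : ℕ) * c (n + 1)) * x ^ n) x := by
  set R : ℝ := ‖x‖ + 1 with hR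
  have hR0 : 0 ≤ R := by positivity
  have hbound : ∀ n z, ‖z‖ ≤ R →
      ‖((n + 1 : ℕ) * c (n + 1)) * z ^ n‖ ≤ C * (R ^ n / n.factorial) := by
    intro n z hz
    have hC := norm_succ_mul_le_div_factorial hc n
    rw [norm_mul, norm_pow]
    calc ‖(n + 1 : ℕ) * c (n + 1)‖ * ‖z‖ ^ n ≤ (C / n.factorial) * R ^ n := by
          have := (norm_nonneg _).trans hC
          gcongr
      _ = _ := by ring
  have hsum : Summable fun n : ℕ => C * (R ^ n / n.factorial) :=
    (Real.summable_pow_div_factorial R).mul_left C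
  have hdiff : HasDerivAt (fun z : ℂ => ∑' n, c (n + 1) * z ^ (n + 1))
      (∑' n, ((n + 1 : ℕ) * c (n + 1)) * x ^ n) x := by
    refine hasDerivAt_tsum_of_isPreconnected (t := Metric.ball 0 R) (y₀ := 0) hsum
      Metric.isOpen_ball (convex_ball _ _).isPreconnected
      (g := fun n z => c (n + 1) * z ^ (n + 1))
      (g' := fun n z => ((n + 1 : ℕ) * c (n + 1)) * z ^ n) ?_ ?_ ?_ ?_ ?_
    · intro n z _
      exact ((hasDerivAt_pow (n + 1) z).const_mul (c (n + 1))).congr_deriv (by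
        rw [Nat.add_sub_cancel]; ring)
    · intro n z hz
      exact hbound n z (by simpa using (mem_ball_zero_iff.1 hz).le)
    · simp [hR]; positivity
    · simp
    · simp [hR]
  have heq : (fun z : ℂ => ∑' n, c n * z ^ n)
      = fun z => c 0 + ∑' n, c (n + 1) * z ^ (n + 1) := by
    funext z
    rw [(summable_mul_pow_of_norm_le_div_factorial hc z).tsum_eq_zero_add]; simp
  rw [heq]
  exact hdiff.const_add (c 0)

/-- A real solution of `w'' = (e^{2s} - k²) w` that is not eventually zero decays at most like
`exp (-2 e^s)`. -/
theorem exists_le_abs_of_solution {k : ℝ} {w w' : ℝ → ℝ}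
    (hw : ∀ s, HasDerivAt w (w' s) s)
    (hw' : ∀ s, HasDerivAt w' ((Real.exp (2 * s) - k ^ 2) * w s) s)
    (hne : ∀ S, ∃ s ≥ S, w s ≠ 0) :
    ∃ c > 0, ∃ S, ∀ s ≥ S, c * Real.exp (-(2 * Real.exp s)) ≤ |w s| := by
  obtain ⟨S₀, hS₀, hq⟩ : ∃ S₀ : ℝ, 0 ≤ S₀ ∧ ∀ s ≥ S₀, 0 ≤ Real.exp (2 * s) - k ^ 2 := by
    refine ⟨k ^ 2, sq_nonneg k, fun s hs => ?_⟩
    have := Real.add_one_le_exp (2 * s)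
    nlinarith [sq_nonneg k]
  have hsq : ∀ s, HasDerivAt (fun s => w s ^ 2) (2 * (w s * w' s)) s := fun s =>
    ((hw s).pow 2).congr_deriv (by norm_num; ring)
  have hflux : MonotoneOn (fun s => w s * w' s) (Set.Ici S₀) := by
    have hd : ∀ s, HasDerivAt (fun s => w s * w' s)
        (w' s * w' s + w s * ((Real.exp (2 * s) - k ^ 2) * w s)) s := fun s => (hw s).mul (hw' s)
    refine monotoneOn_of_hasDerivWithinAt_nonneg (convex_Ici _)
      (fun s _ => (hd s).continuousAt.continuousWithinAt)
      (fun s _ => (hd s).hasDerivWithinAt) fun s hs => ?_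
    rw [interior_Ici] at hs
    nlinarith [mul_nonneg (hq s hs.le) (sq_nonneg (w s)), sq_nonneg (w' s)]
  by_cases hA : ∃ s₀ ≥ S₀, 0 < w s₀ * w' s₀
  · obtain ⟨s₀, hs₀, hpos⟩ := hA
    have hmono : MonotoneOn (fun s => w s ^ 2) (Set.Ici s₀) := by
      refine monotoneOn_of_hasDerivWithinAt_nonneg (convex_Ici _)
        (fun s _ => (hsq s).continuousAt.continuousWithinAt)
        (fun s _ => (hsq s).hasDerivWithinAt) fun s hs => ?_
      rw [interior_Ici] at hs
      have := hflux hs₀ (hs₀.le.trans hs.le : S₀ ≤ s) hs.le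
      simp only at this
      linarith
    refine ⟨|w s₀|, abs_pos.2 (left_ne_zero_of_mul hpos.ne'), s₀, fun s hs => ?_⟩
    have h1 : |w s₀| ≤ |w s| := sq_le_sq.1 (hmono Set.self_mem_Ici hs hs)
    have h2 : Real.exp (-(2 * Real.exp s)) ≤ 1 :=
      Real.exp_le_one_iff.2 (by have := Real.exp_pos s; linarith)
    nlinarith [abs_nonneg (w s₀)]
  push Not at hA
  have hanti : AntitoneOn (fun s => w s ^ 2) (Set.Ici S₀) := by
    refine antitoneOn_of_hasDerivWithinAt_nonpos (convex_Ici _)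
      (fun s _ => (hsq s).continuousAt.continuousWithinAt)
      (fun s _ => (hsq s).hasDerivWithinAt) fun s hs => ?_
    rw [interior_Ici] at hs
    linarith [hA s hs.le]
  have hne' : ∀ s ≥ S₀, w s ≠ 0 := by
    intro s hs h0
    obtain ⟨t, ht, htne⟩ := hne s
    have := hanti hs (hs.le.trans ht : S₀ ≤ t) ht
    simp only [h0] at this
    exact htne (by nlinarith [sq_nonneg (w t)])
  -- After a change of sign the solution is positive, and then it dominates `exp (-2 e^s)`.
  have key : ∀ v v' : ℝ → ℝ, (∀ s, HasDerivAt v (v' s) s) →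
      (∀ s, HasDerivAt v' ((Real.exp (2 * s) - k ^ 2) * v s) s) →
      (∀ s ≥ S₀, 0 < v s) →
      ∃ c > 0, ∃ S, ∀ s ≥ S, c * Real.exp (-(2 * Real.exp s)) ≤ v s := by
    intro v v' hv hv' hpos
    have hz : ∀ s, HasDerivAt (fun s => Real.exp (-(2 * Real.exp s)))
        (Real.exp (-(2 * Real.exp s)) * (-(2 * Real.exp s))) s := fun s =>
      (((Real.hasDerivAt_exp s).const_mul 2).neg).exp
    have hM : ∀ s, HasDerivAt
        (fun s => (v' s + 2 * Real.exp s * v s) * Real.exp (-(2 * Real.exp s)))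
        ((2 * Real.exp s - 3 * Real.exp s ^ 2 - k ^ 2) * v s * Real.exp (-(2 * Real.exp s))) s := by
      intro s
      refine (((hv' s).add (((Real.hasDerivAt_exp s).const_mul 2).mul (hv s))).mul
        (hz s)).congr_deriv ?_
      simp only [Pi.add_apply, Pi.mul_apply]
      rw [show (2 : ℝ) * s = s + s by ring, Real.exp_add]
      ring
    have hManti : AntitoneOn
        (fun s => (v' s + 2 * Real.exp s * v s) * Real.exp (-(2 * Real.exp s))) (Set.Ici S₀) := by
      refine antitoneOn_of_hasDerivWithinAt_nonpos (convex_Ici _)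
        (fun s _ => (hM s).continuousAt.continuousWithinAt)
        (fun s _ => (hM s).hasDerivWithinAt) fun s hs => ?_
      rw [interior_Ici] at hs
      have h1 : 1 ≤ Real.exp s := Real.one_le_exp (hS₀.trans hs.le)
      have h2 : 2 * Real.exp s - 3 * Real.exp s ^ 2 - k ^ 2 ≤ 0 := by nlinarith [sq_nonneg k]
      have h3 : 0 ≤ v s * Real.exp (-(2 * Real.exp s)) := by have := hpos s hs.le; positivity
      nlinarith
    have hg : ∀ s ≥ S₀, 0 ≤ v' s + 2 * Real.exp s * v s := by
      intro s₀ hs₀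
      by_contra! hlt
      set m := (v' s₀ + 2 * Real.exp s₀ * v s₀) * Real.exp (-(2 * Real.exp s₀)) with hm
      have hm0 : m < 0 := mul_neg_of_neg_of_pos hlt (Real.exp_pos _)
      have hv'm : ∀ s ≥ s₀, v' s ≤ m := by
        intro s hs
        have h1 := hManti hs₀ (hs₀.le.trans hs : S₀ ≤ s) hs
        simp only [← hm] at h1
        have h2 : Real.exp (-(2 * Real.exp s)) ≤ 1 :=
          Real.exp_le_one_iff.2 (by have := Real.exp_pos s; linarith)
        have h3 := Real.exp_pos (-(2 * Real.exp s))
        have h4 : 0 < 2 * Real.exp s * v s := by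
          have := hpos s (hs₀.le.trans hs); positivity
        have h5 : v' s + 2 * Real.exp s * v s ≤ m := by
          by_contra! h
          rcases le_or_gt 0 (v' s + 2 * Real.exp s * v s) with h6 | h6
          · nlinarith
          · nlinarith
        linarith
      have hlin : AntitoneOn (fun s => v s - m * s) (Set.Ici s₀) := by
        have hd : ∀ s, HasDerivAt (fun s => v s - m * s) (v' s - m * 1) s := fun s =>
          (hv s).sub ((hasDerivAt_id s).const_mul m)
        refine antitoneOn_of_hasDerivWithinAt_nonpos (convex_Ici _)
          (fun s _ => (hd s).continuousAt.continuousWithinAt)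
          (fun s _ => (hd s).hasDerivWithinAt) fun s hs => ?_
        rw [interior_Ici] at hs
        linarith [hv'm s hs.le]
      have hv0 := hpos s₀ hs₀
      have ht : s₀ ≤ s₀ + v s₀ / (-m) := by
        have : 0 < v s₀ / (-m) := div_pos hv0 (by linarith)
        linarith
      have h1 := hlin Set.self_mem_Ici ht ht
      have h2 := hpos _ (hs₀.le.trans ht)
      have h3 : m * (v s₀ / (-m)) = - v s₀ := by field_simp [hm0.ne]
      simp only [mul_add, h3] at h1
      linarith
    have hmono : MonotoneOn (fun s => v s * Real.exp (2 * Real.exp s)) (Set.Ici S₀) := by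
      have hd : ∀ s, HasDerivAt (fun s => v s * Real.exp (2 * Real.exp s))
          (v' s * Real.exp (2 * Real.exp s)
            + v s * (Real.exp (2 * Real.exp s) * (2 * Real.exp s))) s := fun s =>
        (hv s).mul ((Real.hasDerivAt_exp s).const_mul 2).exp
      refine monotoneOn_of_hasDerivWithinAt_nonneg (convex_Ici _)
        (fun s _ => (hd s).continuousAt.continuousWithinAt)
        (fun s _ => (hd s).hasDerivWithinAt) fun s hs => ?_
      rw [interior_Ici] at hs
      have := mul_nonneg (hg s hs.le) (Real.exp_pos (2 * Real.exp s)).le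
      linarith
    refine ⟨v S₀ * Real.exp (2 * Real.exp S₀), mul_pos (hpos S₀ le_rfl) (Real.exp_pos _), S₀,
      fun s hs => ?_⟩
    have h1 := hmono Set.self_mem_Ici hs hs
    simp only at h1
    rw [Real.exp_neg, ← div_eq_mul_inv, div_le_iff₀ (Real.exp_pos _)]
    exact h1
  have hcont : ContinuousOn w (Set.Ici S₀) := fun s _ => (hw s).continuousAt.continuousWithinAt
  have hconn : IsPreconnected (Set.Ici S₀) := (convex_Ici S₀).isPreconnected
  rcases lt_or_gt_of_ne (hne' S₀ le_rfl) with hneg | hpos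
  · have hall : ∀ s ≥ S₀, 0 < -w s := by
      intro s hs
      by_contra! h
      obtain ⟨t, ht, ht0⟩ := hconn.intermediate_value (a := S₀) (b := s) Set.self_mem_Ici hs hcont
        ⟨hneg.le, by linarith⟩
      exact hne' t ht ht0
    obtain ⟨c, hc, S, h⟩ := key (fun s => -w s) (fun s => -w' s) (fun s => (hw s).neg)
      (fun s => (hw' s).neg.congr_deriv (by ring)) hall
    exact ⟨c, hc, S, fun s hs => (h s hs).trans (neg_le_abs _)⟩
  · have hall : ∀ s ≥ S₀, 0 < w s := by
      intro s hs
      by_contra! h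
      obtain ⟨t, ht, ht0⟩ := hconn.intermediate_value (a := s) (b := S₀) hs Set.self_mem_Ici hcont
        ⟨h, hpos.le⟩
      exact hne' t ht ht0
    obtain ⟨c, hc, S, h⟩ := key w w' hw hw' hall
    exact ⟨c, hc, S, fun s hs => (h s hs).trans (le_abs_self _)⟩

/-- The Taylor coefficients of `x ↦ x^{-ν/2} I_ν(2 √x)`. -/
noncomputable def besselCoeff (ν : ℂ) (n : ℕ) : ℂ :=
  1 / ((n.factorial : ℂ) * Complex.Gamma (ν + n + 1))

/-- The entire factor of `besselI`, as a function of `z² / 4`. -/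
noncomputable def besselEntire (ν x : ℂ) : ℂ := ∑' n, besselCoeff ν n * x ^ n

/-- The derivative of `besselEntire`. -/
noncomputable def besselEntireDeriv (ν x : ℂ) : ℂ :=
  ∑' n, ((n + 1 : ℕ) * besselCoeff ν (n + 1)) * x ^ n

/-- The second derivative of `besselEntire`. -/
noncomputable def besselEntireDeriv₂ (ν x : ℂ) : ℂ :=
  ∑' n, ((n + 1 : ℕ) * ((n + 1 + 1 : ℕ) * besselCoeff ν (n + 1 + 1))) * x ^ n

theorem besselCoeff_succ {ν : ℂ} (hν : ν.re = 0) (n : ℕ) :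
    (n + 1) * (ν + n + 1) * besselCoeff ν (n + 1) = besselCoeff ν n := by
  have hre : 0 < (ν + n + 1).re := by simp [hν]; positivity
  have h0 : ν + n + 1 ≠ 0 := fun h => by simp [h] at hre
  have hΓ := Complex.Gamma_ne_zero_of_re_pos hre
  have hfac : (n.factorial : ℂ) ≠ 0 := by exact_mod_cast n.factorial_ne_zero
  have hn : (n : ℂ) + 1 ≠ 0 := by exact_mod_cast n.succ_ne_zero
  unfold besselCoeff
  rw [show ν + (n + 1 : ℕ) + 1 = (ν + n + 1) + 1 by push_cast; ring, Complex.Gamma_add_one _ h0,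
    Nat.factorial_succ]
  push_cast
  field_simp

theorem norm_besselCoeff_le {ν : ℂ} (hν : ν.re = 0) (n : ℕ) :
    ‖besselCoeff ν n‖ ≤ ‖besselCoeff ν 0‖ / n.factorial := by
  induction n with
  | zero => simp
  | succ n ih =>
    have h1 : (1 : ℝ) ≤ ‖ν + n + 1‖ := by
      refine le_trans ?_ (Complex.re_le_norm _)
      simp [hν]
    have h2 := congrArg norm (besselCoeff_succ hν n)
    rw [norm_mul, norm_mul, show ‖(n : ℂ) + 1‖ = (n : ℝ) + 1 by
      exact_mod_cast Complex.norm_natCast (n + 1)] at h2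
    rw [le_div_iff₀ (by positivity)] at ih ⊢
    rw [Nat.factorial_succ]
    push_cast
    refine le_trans ?_ ih
    rw [← h2]
    have : 0 ≤ ((n : ℝ) + 1) * ‖besselCoeff ν (n + 1)‖ * n.factorial := by positivity
    nlinarith

theorem hasDerivAt_besselEntire {ν : ℂ} (hν : ν.re = 0) (x : ℂ) :
    HasDerivAt (besselEntire ν) (besselEntireDeriv ν x) x :=
  hasDerivAt_tsum_of_norm_le_div_factorial (norm_besselCoeff_le hν) x

theorem hasDerivAt_besselEntireDeriv {ν : ℂ} (hν : ν.re = 0) (x : ℂ) :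
    HasDerivAt (besselEntireDeriv ν) (besselEntireDeriv₂ ν x) x :=
  hasDerivAt_tsum_of_norm_le_div_factorial
    (norm_succ_mul_le_div_factorial (norm_besselCoeff_le hν)) x

/-- The differential equation `x G'' + (ν + 1) G' = G` of the entire factor. -/
theorem besselEntire_ode {ν : ℂ} (hν : ν.re = 0) (x : ℂ) :
    x * besselEntireDeriv₂ ν x + (ν + 1) * besselEntireDeriv ν x = besselEntire ν x := by
  have hb := norm_besselCoeff_le hν
  have hb₁ := norm_succ_mul_le_div_factorial hb
  have hb₂ := norm_succ_mul_le_div_factorial hb₁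
  have h₁ := summable_mul_pow_of_norm_le_div_factorial hb₁ x
  have h₂ := summable_mul_pow_of_norm_le_div_factorial hb₂ x
  have hs : Summable fun n : ℕ =>
      (n : ℂ) * ((n + 1 : ℕ) * besselCoeff ν (n + 1)) * x ^ n := by
    rw [← summable_nat_add_iff 1]
    exact (h₂.mul_left x).congr fun n => by ring
  have hshift : x * besselEntireDeriv₂ ν x
      = ∑' n : ℕ, (n : ℂ) * ((n + 1 : ℕ) * besselCoeff ν (n + 1)) * x ^ n := by
    rw [hs.tsum_eq_zero_add, besselEntireDeriv₂, ← tsum_mul_left]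
    simp only [Nat.cast_zero, zero_mul, zero_add]
    exact tsum_congr fun n => by ring
  rw [hshift, besselEntireDeriv, ← tsum_mul_left, ← hs.tsum_add (h₁.mul_left (ν + 1)),
    besselEntire]
  refine tsum_congr fun n => ?_
  rw [← besselCoeff_succ hν n]
  push_cast
  ring

/-- `s ↦ e^{2s} / 4`, the argument at which `besselEntire` enters `I_ν(e^s)`. -/
noncomputable def quarterExp (s : ℝ) : ℂ := ((Real.exp (2 * s) / 4 : ℝ) : ℂ)

theorem hasDerivAt_quarterExp (s : ℝ) : HasDerivAt quarterExp (2 * quarterExp s) s := by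
  have h : HasDerivAt (fun s : ℝ => Real.exp (2 * s) / 4) (2 * (Real.exp (2 * s) / 4)) s :=
    ((((hasDerivAt_id s).const_mul 2).exp).div_const 4).congr_deriv (by simp; ring)
  exact h.ofReal_comp.congr_deriv (by simp [quarterExp])

/-- `2^ν e^{-νs}` times the derivative of `s ↦ I_ν(e^s)`. -/
noncomputable def besselLogSlope (ν x : ℂ) : ℂ :=
  ν * besselEntire ν x + 2 * x * besselEntireDeriv ν x

theorem besselI_exp (ν : ℂ) (s : ℝ) :
    besselI ν (Real.exp s : ℝ)
      = Complex.exp (ν * (s - Real.log 2 : ℝ)) * besselEntire ν (quarterExp s) := by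
  have hpow : ((Real.exp s : ℝ) / 2 : ℂ) ^ ν = Complex.exp (ν * (s - Real.log 2 : ℝ)) := by
    have h : ((Real.exp s : ℝ) / 2 : ℂ) = ((Real.exp s / 2 : ℝ) : ℂ) := by push_cast; rfl
    have hpos : 0 < Real.exp s / 2 := by positivity
    rw [h, Complex.cpow_def_of_ne_zero (by exact_mod_cast hpos.ne'), ← Complex.ofReal_log hpos.le,
      Real.log_div (Real.exp_pos s).ne' two_ne_zero, Real.log_exp, mul_comm]
  have hsq : ((Real.exp s : ℝ) : ℂ) ^ 2 / 4 = quarterExp s := by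
    rw [quarterExp, show (2 : ℝ) * s = s + s by ring, Real.exp_add]
    push_cast; ring
  rw [besselI, hpow, hsq, besselEntire]
  congr 1
  exact tsum_congr fun n => by rw [besselCoeff]; ring

theorem hasDerivAt_besselI_exp {ν : ℂ} (hν : ν.re = 0) (s : ℝ) :
    HasDerivAt (fun s : ℝ => besselI ν (Real.exp s : ℝ))
      (Complex.exp (ν * (s - Real.log 2 : ℝ)) * besselLogSlope ν (quarterExp s)) s := by
  simp only [besselI_exp]
  have he : HasDerivAt (fun s : ℝ => Complex.exp (ν * (s - Real.log 2 : ℝ)))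
      (Complex.exp (ν * (s - Real.log 2 : ℝ)) * (ν * (1 : ℝ))) s :=
    ((((hasDerivAt_id s).sub_const (Real.log 2)).ofReal_comp).const_mul ν).cexp
  have hG := (hasDerivAt_besselEntire hν (quarterExp s)).comp s (hasDerivAt_quarterExp s)
  refine (he.mul hG).congr_deriv ?_
  simp only [besselLogSlope, Function.comp, Complex.ofReal_one]
  ring

theorem hasDerivAt_besselI_exp_deriv {ν : ℂ} (hν : ν.re = 0) (s : ℝ) :
    HasDerivAt
      (fun s : ℝ => Complex.exp (ν * (s - Real.log 2 : ℝ)) * besselLogSlope ν (quarterExp s))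
      ((Real.exp (2 * s) + ν ^ 2) * besselI ν (Real.exp s : ℝ)) s := by
  have he : HasDerivAt (fun s : ℝ => Complex.exp (ν * (s - Real.log 2 : ℝ)))
      (Complex.exp (ν * (s - Real.log 2 : ℝ)) * (ν * (1 : ℝ))) s :=
    ((((hasDerivAt_id s).sub_const (Real.log 2)).ofReal_comp).const_mul ν).cexp
  have hx := hasDerivAt_quarterExp s
  have hG := (hasDerivAt_besselEntire hν (quarterExp s)).comp s hx
  have hG' := (hasDerivAt_besselEntireDeriv hν (quarterExp s)).comp s hx
  have h4 : ((Real.exp (2 * s) : ℝ) : ℂ) = 4 * quarterExp s := by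
    rw [quarterExp]; push_cast; ring
  refine (he.mul ((hG.const_mul ν).add ((hx.const_mul 2).mul hG'))).congr_deriv ?_
  simp only [besselI_exp, h4, Function.comp, Complex.ofReal_one, Pi.add_apply, Pi.mul_apply]
  rw [← besselEntire_ode hν (quarterExp s)]
  ring

/-- `I_ν` and `I_{-ν}` have a nonzero Wronskian. -/
theorem besselI_wronskian_ne_zero {ν : ℂ} (hν : ν.re = 0) (hν0 : ν ≠ 0) (s : ℝ) :
    besselEntire ν (quarterExp s) * besselLogSlope (-ν) (quarterExp s)
      - besselLogSlope ν (quarterExp s) * besselEntire (-ν) (quarterExp s) ≠ 0 := by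
  have hν' : (-ν).re = 0 := by simp [hν]
  set W : ℂ → ℂ := fun x => besselEntire ν x * besselLogSlope (-ν) x
      - besselLogSlope ν x * besselEntire (-ν) x with hW
  have hcont : Continuous W := by
    have h1 : ∀ μ : ℂ, μ.re = 0 → Continuous (besselEntire μ) := fun μ hμ =>
      continuous_iff_continuousAt.2 fun x => (hasDerivAt_besselEntire hμ x).continuousAt
    have h2 : ∀ μ : ℂ, μ.re = 0 → Continuous (besselLogSlope μ) := fun μ hμ =>
      (continuous_const.mul (h1 μ hμ)).add ((continuous_const.mul continuous_id).mul
        (continuous_iff_continuousAt.2 fun x => (hasDerivAt_besselEntireDeriv hμ x).continuousAt))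
    exact ((h1 ν hν).mul (h2 _ hν')).sub ((h2 ν hν).mul (h1 _ hν'))
  have hcancel : ∀ s : ℝ, Complex.exp (ν * (s - Real.log 2 : ℝ))
      * Complex.exp (-ν * (s - Real.log 2 : ℝ)) = 1 := fun s => by
    rw [← Complex.exp_add]; simp
  have hform : ∀ s : ℝ, W (quarterExp s) = besselI ν (Real.exp s : ℝ)
        * (Complex.exp (-ν * (s - Real.log 2 : ℝ)) * besselLogSlope (-ν) (quarterExp s))
      - Complex.exp (ν * (s - Real.log 2 : ℝ)) * besselLogSlope ν (quarterExp s)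
        * besselI (-ν) (Real.exp s : ℝ) := fun s => by
    simp only [besselI_exp, hW]
    linear_combination (-(besselEntire ν (quarterExp s) * besselLogSlope (-ν) (quarterExp s)
      - besselLogSlope ν (quarterExp s) * besselEntire (-ν) (quarterExp s))) * hcancel s
  have hderiv : ∀ s : ℝ, HasDerivAt (fun s => W (quarterExp s)) 0 s := by
    intro s
    rw [funext hform]
    refine (((hasDerivAt_besselI_exp hν s).mul (hasDerivAt_besselI_exp_deriv hν' s)).sub
      ((hasDerivAt_besselI_exp_deriv hν s).mul (hasDerivAt_besselI_exp hν' s))).congr_deriv ?_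
    ring
  have hconst : ∀ t, W (quarterExp t) = W (quarterExp s) := fun t =>
    is_const_of_deriv_eq_zero (fun u => (hderiv u).differentiableAt) (fun u => (hderiv u).deriv) t s
  have hx0 : Tendsto quarterExp atBot (𝓝 0) := by
    have h : Tendsto (fun s : ℝ => Real.exp (2 * s) / 4) atBot (𝓝 (0 / 4)) :=
      (Real.tendsto_exp_atBot.comp (tendsto_id.const_mul_atBot two_pos)).div_const 4
    rw [zero_div] at h
    exact (Complex.continuous_ofReal.tendsto 0).comp h
  have hlim : Tendsto (fun t => W (quarterExp t)) atBot (𝓝 (W 0)) := (hcont.tendsto 0).comp hx0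
  simp only [hconst] at hlim
  have hW0 : W (quarterExp s) = W 0 := tendsto_nhds_unique tendsto_const_nhds hlim
  have hG0 : ∀ μ : ℂ, μ.re = 0 → besselEntire μ 0 ≠ 0 := by
    intro μ hμ
    have hval : besselEntire μ 0 = besselCoeff μ 0 := by
      rw [besselEntire, tsum_eq_single 0 (fun n hn => by simp [hn])]
      simp
    rw [hval, besselCoeff]
    have := Complex.Gamma_ne_zero_of_re_pos (s := μ + (0 : ℕ) + 1) (by simp [hμ])
    simpa using this
  change W (quarterExp s) ≠ 0
  rw [hW0, show W 0 = -2 * ν * (besselEntire ν 0 * besselEntire (-ν) 0) by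
    simp only [hW, besselLogSlope]; ring]
  exact mul_ne_zero (mul_ne_zero (by norm_num) hν0) (mul_ne_zero (hG0 ν hν) (hG0 _ hν'))

/-- `K_{ik}` decays at most exponentially along the positive real axis. -/
theorem exists_le_norm_besselK {k : ℝ} (hk : k ≠ 0) :
    ∃ c > 0, ∃ T, ∀ t ≥ T, c * Real.exp (-(2 * t)) ≤ ‖besselK (Complex.I * k) (t : ℝ)‖ := by
  set ν : ℂ := Complex.I * k with hνdef
  have hν : ν.re = 0 := by simp [hνdef]
  have hν' : (-ν).re = 0 := by simp [hν]
  have hν0 : ν ≠ 0 := mul_ne_zero Complex.I_ne_zero (by exact_mod_cast hk)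
  have hνsq : ν ^ 2 = -(k : ℂ) ^ 2 := by rw [hνdef, mul_pow, Complex.I_sq]; ring
  have hsin : Complex.sin (ν * Real.pi) ≠ 0 := by
    rw [Ne, Complex.sin_eq_zero_iff]
    rintro ⟨n, hn⟩
    have him := congrArg Complex.im hn
    simp [hνdef, hk, Real.pi_ne_zero] at him
  set D : ℝ → ℂ := fun s => besselI (-ν) (Real.exp s : ℝ) - besselI ν (Real.exp s : ℝ) with hD
  set D' : ℝ → ℂ := fun s =>
    Complex.exp (-ν * (s - Real.log 2 : ℝ)) * besselLogSlope (-ν) (quarterExp s)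
      - Complex.exp (ν * (s - Real.log 2 : ℝ)) * besselLogSlope ν (quarterExp s) with hD'
  have hd : ∀ s, HasDerivAt D (D' s) s := fun s =>
    (hasDerivAt_besselI_exp hν' s).sub (hasDerivAt_besselI_exp hν s)
  have hd' : ∀ s, HasDerivAt D' (((Real.exp (2 * s) - k ^ 2 : ℝ) : ℂ) * D s) s := fun s =>
    ((hasDerivAt_besselI_exp_deriv hν' s).sub (hasDerivAt_besselI_exp_deriv hν s)).congr_deriv (by
      simp only [hD, neg_sq, hνsq]; push_cast; ring)
  have hne : ¬ ∃ S, ∀ s ≥ S, D s = 0 := by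
    rintro ⟨S, hS⟩
    have h0 : D (S + 1) = 0 := hS _ (by linarith)
    have h1 : D' (S + 1) = 0 := by
      have hev : D =ᶠ[𝓝 (S + 1)] fun _ => 0 := by
        filter_upwards [lt_mem_nhds (show S < S + 1 by linarith)] with s hs using hS s hs.le
      exact (hd (S + 1)).unique ((hasDerivAt_const _ (0 : ℂ)).congr_of_eventuallyEq hev)
    refine besselI_wronskian_ne_zero hν hν0 (S + 1) ?_
    have hc : Complex.exp (ν * ((S + 1) - Real.log 2 : ℝ))
        * Complex.exp (-ν * ((S + 1) - Real.log 2 : ℝ)) = 1 := by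
      rw [← Complex.exp_add]; simp
    simp only [hD, besselI_exp] at h0
    simp only [hD'] at h1
    set e := Complex.exp (ν * ((S + 1) - Real.log 2 : ℝ))
    set f := Complex.exp (-ν * ((S + 1) - Real.log 2 : ℝ))
    set x := quarterExp (S + 1)
    linear_combination (-(besselEntire ν x * besselLogSlope (-ν) x
      - besselLogSlope ν x * besselEntire (-ν) x)) * hc
      + e * besselEntire ν x * h1 - e * besselLogSlope ν x * h0
  have hbound : ∃ c > 0, ∃ S, ∀ s ≥ S, c * Real.exp (-(2 * Real.exp s)) ≤ ‖D s‖ := by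
    by_cases hre : ∀ S, ∃ s ≥ S, (D s).re ≠ 0
    · obtain ⟨c, hc, S, h⟩ := exists_le_abs_of_solution (k := k) (w := fun s => (D s).re)
        (w' := fun s => (D' s).re)
        (fun s => Complex.reCLM.hasFDerivAt.comp_hasDerivAt s (hd s))
        (fun s => (Complex.reCLM.hasFDerivAt.comp_hasDerivAt s (hd' s)).congr_deriv
          (Complex.re_ofReal_mul _ _)) hre
      exact ⟨c, hc, S, fun s hs => (h s hs).trans (Complex.abs_re_le_norm _)⟩
    · have him : ∀ S, ∃ s ≥ S, (D s).im ≠ 0 := by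
        intro S
        by_contra! h
        push Not at hre
        obtain ⟨S', h'⟩ := hre
        exact hne ⟨max S S', fun s hs => Complex.ext (h' s ((le_max_right _ _).trans hs))
          (h s ((le_max_left _ _).trans hs))⟩
      obtain ⟨c, hc, S, h⟩ := exists_le_abs_of_solution (k := k) (w := fun s => (D s).im)
        (w' := fun s => (D' s).im)
        (fun s => Complex.imCLM.hasFDerivAt.comp_hasDerivAt s (hd s))
        (fun s => (Complex.imCLM.hasFDerivAt.comp_hasDerivAt s (hd' s)).congr_deriv
          (Complex.im_ofReal_mul _ _)) him
      exact ⟨c, hc, S, fun s hs => (h s hs).trans (Complex.abs_im_le_norm _)⟩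
  obtain ⟨c, hc, S, h⟩ := hbound
  have hA : (Real.pi / 2 : ℂ) / Complex.sin (ν * Real.pi) ≠ 0 :=
    div_ne_zero (by simp [Real.pi_ne_zero]) hsin
  refine ⟨‖(Real.pi / 2 : ℂ) / Complex.sin (ν * Real.pi)‖ * c, mul_pos (norm_pos_iff.2 hA) hc,
    Real.exp S, fun t ht => ?_⟩
  have htpos : 0 < t := (Real.exp_pos S).trans_le ht
  have hlog := h (Real.log t) ((Real.le_log_iff_exp_le htpos).2 ht)
  simp only [hD, Real.exp_log htpos] at hlog
  rw [besselK, mul_div_right_comm, norm_mul, mul_assoc]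
  gcongr

/-- If the incoming coefficients `(a_n)` belong to `l^{2,∞}` and the Fourier modes
`a_n y^{1/2} I_{-ik}(|n|y/r) + b_n y^{1/2} K_{ik}(|n|y/r)` are square-summable for
each `y > 1`, then `Σ_{n} |b_n K_{ik}(|n|y/r)|² < ∞` for each `y > 1`, and
consequently `(b_n) ∈ l^{2,-∞}`: `Σ |b_n|² ρ^{-|n|} < ∞` for some `ρ > 1`. -/
theorem outgoing_coefficients_in_l2_minus_infty
    (r k : ℝ) (hr : 0 < r) (hk : k ≠ 0)
    (a b : ℤ → ℂ)
    (ha : ∀ ρ : ℝ, 1 < ρ → Summable (fun n : ℤ => ‖a n‖ ^ 2 * ρ ^ n.natAbs))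
    (haI : ∀ y : ℝ, 1 < y → Summable (fun n : ℤ =>
      ‖a n * besselI (-(Complex.I * k)) (((n.natAbs : ℝ) * y / r : ℝ) : ℂ)‖ ^ 2))
    (hu : ∀ y : ℝ, 1 < y → Summable (fun n : ℤ =>
      ‖a n * besselI (-(Complex.I * k)) (((n.natAbs : ℝ) * y / r : ℝ) : ℂ)
        + b n * besselK (Complex.I * k) (((n.natAbs : ℝ) * y / r : ℝ) : ℂ)‖ ^ 2)) :
    (∀ y : ℝ, 1 < y → Summable (fun n : ℤ =>
      ‖b n * besselK (Complex.I * k) (((n.natAbs : ℝ) * y / r : ℝ) : ℂ)‖ ^ 2))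
    ∧ ∃ ρ : ℝ, 1 < ρ ∧ Summable (fun n : ℤ => ‖b n‖ ^ 2 * ρ ^ (-(n.natAbs : ℤ))) := by
  have hK : ∀ y : ℝ, 1 < y → Summable (fun n : ℤ =>
      ‖b n * besselK (Complex.I * k) (((n.natAbs : ℝ) * y / r : ℝ) : ℂ)‖ ^ 2) := by
    intro y hy
    refine Summable.of_nonneg_of_le (fun _ => sq_nonneg _) (fun n => ?_)
      (((hu y hy).mul_left 2).add ((haI y hy).mul_left 2))
    set A := a n * besselI (-(Complex.I * k)) (((n.natAbs : ℝ) * y / r : ℝ) : ℂ)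
    set B := b n * besselK (Complex.I * k) (((n.natAbs : ℝ) * y / r : ℝ) : ℂ)
    have h : ‖B‖ ≤ ‖A + B‖ + ‖A‖ := by simpa using norm_sub_le (A + B) A
    nlinarith [norm_nonneg B, sq_nonneg (‖A + B‖ - ‖A‖)]
  refine ⟨hK, ?_⟩
  obtain ⟨c, hc, T, hT⟩ := exists_le_norm_besselK hk
  refine ⟨Real.exp (8 / r), Real.one_lt_exp_iff.2 (by positivity), ?_⟩
  refine Summable.of_norm_bounded_eventually ((hK 2 one_lt_two).mul_left (c ^ 2)⁻¹) ?_
  have hlarge : ∀ᶠ n : ℤ in cofinite, T * r / 2 ≤ (n.natAbs : ℝ) := by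
    have h : Tendsto (fun n : ℤ => ‖n‖) cofinite atTop :=
      (tendsto_norm_cocompact_atTop (E := ℝ)).comp Int.tendsto_coe_cofinite
    filter_upwards [h.eventually_ge_atTop (T * r / 2)] with n hn
    rwa [Int.norm_eq_abs, ← Int.cast_abs, ← Nat.cast_natAbs] at hn
  filter_upwards [hlarge] with n hn
  have hb := hT ((n.natAbs : ℝ) * 2 / r) (by
    rw [ge_iff_le, le_div_iff₀ hr]; linarith)
  have hexp : Real.exp (8 / r) ^ (-(n.natAbs : ℤ))
      = Real.exp (-(2 * ((n.natAbs : ℝ) * 2 / r))) ^ 2 := by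
    rw [zpow_neg, zpow_natCast, ← Real.exp_nat_mul, ← Real.exp_nat_mul, ← Real.exp_neg]
    congr 1
    push_cast
    ring
  rw [Real.norm_of_nonneg (by positivity), hexp, norm_mul, mul_pow, inv_mul_eq_div,
    le_div_iff₀ (by positivity)]
  calc ‖b n‖ ^ 2 * Real.exp (-(2 * ((n.natAbs : ℝ) * 2 / r))) ^ 2 * c ^ 2
      = ‖b n‖ ^ 2 * (c * Real.exp (-(2 * ((n.natAbs : ℝ) * 2 / r)))) ^ 2 := by ring
    _ ≤ _ := by gcongr
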